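/- arXiv:1108.3587 — 2 statements merged into one kernel-verified Lean document; each statement's English description precedes it below -/
import Mathlib

section
/- For n ≥ 1 and k ≥ 1 define the operators on ℂ[t₁,t₂,…,s₁,s₂,…]: L_k = Σ_{j=1}^{k−1} ∂²/∂t_j∂t_{k−j} + n ∂/∂t_k + Σ_{j≥1} j t_j ∂/∂t_{j+k} − Σ_{j≥k+1} j s_j ∂/∂s_{j−k} − Σ_{j=1}^{k−1} j s_j ∂/∂t_{k−j} − n k s_k; L_0 = Σ_{j≥1} j t_j ∂/∂t_j − Σ_{j≥1} j s_j ∂/∂s_j; and L_{−k} = −Σ_{j=1}^{k−1} ∂²/∂s_j∂s_{k−j} − n ∂/∂s_k − Σ_{j≥1} j s_j ∂/∂s_{j+k} + Σ_{j≥k+1} j t_j ∂/∂t_{j−k} + Σ_{j=1}^{k−1} j t_j ∂/∂s_{k−j} + n k t_k. Then [L_k, L_l] = (k−l)L_{k+l} for all k, l ∈ ℤ (a centerless Virasoro algebra). -/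
open MvPolynomial

namespace ALVir

noncomputable section

abbrev P := MvPolynomial (ℕ ⊕ ℕ) ℂ

/-- derivative as a plain linear map -/
def D (v : ℕ ⊕ ℕ) : P →ₗ[ℂ] P := (pderiv v : Derivation ℂ P P).toLinearMap

/-- multiplication by a variable -/
def M (v : ℕ ⊕ ℕ) : P →ₗ[ℂ] P := LinearMap.mulLeft ℂ (X v)

lemma D_apply (v) (p : P) : D v p = pderiv v p := rfl
lemma M_apply (v) (p : P) : M v p = X v * p := rfl

def c (n : ℕ) : ℤ → (P →ₗ[ℂ] P)
  | Int.ofNat 0 => (n : ℂ) • LinearMap.id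
  | Int.ofNat (i+1) => D (Sum.inl i)
  | Int.negSucc i => D (Sum.inr i)

def b : ℤ → (P →ₗ[ℂ] P)
  | Int.ofNat 0 => 0
  | Int.ofNat (i+1) => D (Sum.inl i) - ((i : ℂ) + 1) • M (Sum.inr i)
  | Int.negSucc i => ((i : ℂ) + 1) • M (Sum.inl i) - D (Sum.inr i)

lemma c_zero (n : ℕ) (z : ℤ) (h : z = 0) (p : P) : c n z p = (n : ℂ) • p := by
  subst h; rfl
lemma c_pos (n : ℕ) (z : ℤ) (i : ℕ) (h : z = i + 1) (p : P) :
    c n z p = pderiv (Sum.inl i) p := by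
  subst h; rfl
lemma c_neg (n : ℕ) (z : ℤ) (i : ℕ) (h : z = -(i + 1)) (p : P) :
    c n z p = pderiv (Sum.inr i) p := by
  have : z = Int.negSucc i := by omega
  subst this; rfl
lemma b_zero (z : ℤ) (h : z = 0) (p : P) : b z p = 0 := by
  subst h; rfl
lemma b_pos (z : ℤ) (i : ℕ) (h : z = i + 1) (p : P) :
    b z p = pderiv (Sum.inl i) p - ((i : ℂ) + 1) • (X (Sum.inr i) * p) := by
  subst h; rfl
lemma b_neg (z : ℤ) (i : ℕ) (h : z = -(i + 1)) (p : P) :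
    b z p = ((i : ℂ) + 1) • (X (Sum.inl i) * p) - pderiv (Sum.inr i) p := by
  have : z = Int.negSucc i := by omega
  subst this; rfl

lemma int_cases (z : ℤ) : z = 0 ∨ (∃ i : ℕ, z = i + 1) ∨ (∃ i : ℕ, z = -(i + 1)) := by
  rcases lt_trichotomy z 0 with h | h | h
  · exact Or.inr (Or.inr ⟨(-z - 1).toNat, by omega⟩)
  · exact Or.inl h
  · exact Or.inr (Or.inl ⟨(z - 1).toNat, by omega⟩)

@[simp] lemma c_zero' (n : ℕ) (p : P) : c n 0 p = (n : ℂ) • p := rfl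
@[simp] lemma c_pos' (n : ℕ) (i : ℕ) (p : P) :
    c n ((i : ℤ) + 1) p = pderiv (Sum.inl i) p := rfl
@[simp] lemma c_neg' (n : ℕ) (i : ℕ) (p : P) :
    c n (-((i : ℤ) + 1)) p = pderiv (Sum.inr i) p := c_neg n _ i rfl p
@[simp] lemma b_zero' (p : P) : b 0 p = 0 := rfl
@[simp] lemma b_pos' (i : ℕ) (p : P) :
    b ((i : ℤ) + 1) p = pderiv (Sum.inl i) p - ((i : ℂ) + 1) • (X (Sum.inr i) * p) := rfl
@[simp] lemma b_neg' (i : ℕ) (p : P) :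
    b (-((i : ℤ) + 1)) p = ((i : ℂ) + 1) • (X (Sum.inl i) * p) - pderiv (Sum.inr i) p :=
  b_neg _ i rfl p

lemma pd_comm (v w : ℕ ⊕ ℕ) (p : P) : pderiv v (pderiv w p) = pderiv w (pderiv v p) := by
  have h : ⁅(pderiv v : Derivation ℂ P P), (pderiv w : Derivation ℂ P P)⁆ = 0 := by
    apply MvPolynomial.derivation_ext
    intro i
    classical
    simp only [Derivation.commutator_apply, pderiv_X, Pi.single_apply, Derivation.coe_zero,
      Pi.zero_apply]
    split_ifs <;> simp
  have := congrArg (fun d => d p) h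
  simpa [Derivation.commutator_apply, sub_eq_zero] using this

lemma pd_mul (v w : ℕ ⊕ ℕ) (p : P) :
    pderiv v (X w * p) = X w * pderiv v p + (if w = v then p else 0) := by
  classical
  rw [Derivation.leibniz, pderiv_X, Pi.single_apply]
  split_ifs <;> simp

lemma c_comm (n : ℕ) (i j : ℤ) (p : P) : c n i (c n j p) = c n j (c n i p) := by
  rcases int_cases i with rfl | ⟨i', rfl⟩ | ⟨i', rfl⟩ <;>
  rcases int_cases j with rfl | ⟨j', rfl⟩ | ⟨j', rfl⟩ <;>
  simp only [c_zero', c_pos', c_neg', Derivation.map_smul] <;> apply pd_comm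

lemma c_b (n : ℕ) (j m : ℤ) (p : P) :
    c n j (b m p) = b m (c n j p) + (if m + j = 0 then -(m : ℂ) else 0) • p := by
  rcases int_cases j with rfl | ⟨j', rfl⟩ | ⟨j', rfl⟩ <;>
  rcases int_cases m with rfl | ⟨m', rfl⟩ | ⟨m', rfl⟩ <;>
  simp only [c_zero', c_pos', c_neg', b_zero', b_pos', b_neg', Derivation.map_smul,
    map_sub, map_zero, pd_mul, Sum.inl.injEq, Sum.inr.injEq, reduceCtorEq, if_false]
  · simp
  · rw [if_neg (by omega)]
    simp only [smul_eq_C_mul, map_zero]; ring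
  · rw [if_neg (by omega)]
    simp only [smul_eq_C_mul, map_zero]; ring
  · simp
  · rw [if_neg (by omega), pd_comm]
    simp only [smul_eq_C_mul, map_zero]; ring
  · rw [pd_comm]
    by_cases h : m' = j'
    · rw [if_pos h, if_pos (by omega)]
      push_cast
      simp only [smul_eq_C_mul, map_neg, map_add]; ring
    · rw [if_neg h, if_neg (by omega)]
      simp only [smul_eq_C_mul, map_zero]; ring
  · simp
  · rw [pd_comm]
    by_cases h : m' = j'
    · rw [if_pos h, if_pos (by omega)]
      push_cast
      simp only [smul_eq_C_mul, map_neg, map_add]; ring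
    · rw [if_neg h, if_neg (by omega)]
      simp only [smul_eq_C_mul, map_zero]; ring
  · rw [if_neg (by omega), pd_comm]
    simp only [smul_eq_C_mul, map_zero]; ring

lemma b_comm (i j : ℤ) (p : P) : b i (b j p) = b j (b i p) := by
  rcases int_cases j with rfl | ⟨j', rfl⟩ | ⟨j', rfl⟩ <;>
  rcases int_cases i with rfl | ⟨m', rfl⟩ | ⟨m', rfl⟩ <;>
  simp only [b_zero', b_pos', b_neg', Derivation.map_smul,
    map_sub, map_zero, pd_mul, Sum.inl.injEq, Sum.inr.injEq, reduceCtorEq, if_false]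
  · simp
  · simp
  · simp
  · rw [pd_comm (Sum.inl m') (Sum.inl j')]
    simp only [smul_eq_C_mul]; ring
  · rw [pd_comm (Sum.inr m') (Sum.inl j')]
    by_cases h : m' = j'
    · subst h
      simp only [smul_eq_C_mul, if_true]; ring
    · rw [if_neg h, if_neg (Ne.symm h)]
      simp only [smul_eq_C_mul]; ring
  · simp
  · rw [pd_comm (Sum.inl m') (Sum.inr j')]
    by_cases h : m' = j'
    · subst h
      simp only [smul_eq_C_mul, if_true]; ring
    · rw [if_neg h, if_neg (Ne.symm h)]
      simp only [smul_eq_C_mul]; ring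
  · rw [pd_comm (Sum.inr m') (Sum.inr j')]
    simp only [smul_eq_C_mul]; ring

/-- variables bounded by N -/
def Bd (p : P) (N : ℕ) : Prop :=
  ∀ v ∈ p.vars, Sum.elim (fun a => a < N) (fun a => a < N) v

lemma exists_Bd (p : P) : ∃ N, Bd p N := by
  refine ⟨p.vars.sup (Sum.elim id id) + 1, ?_⟩
  intro v hv
  have := Finset.le_sup (f := (Sum.elim id id : ℕ ⊕ ℕ → ℕ)) hv
  rcases v with a | a <;> simp at this ⊢ <;> omega

lemma c_vanish (n : ℕ) {p : P} {N : ℕ} (h : Bd p N) (j : ℤ) (hj : j < -N ∨ (N : ℤ) < j) :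
    c n j p = 0 := by
  rcases int_cases j with hi | ⟨i, hi⟩ | ⟨i, hi⟩
  · omega
  · rw [c_pos n _ _ hi]
    apply pderiv_eq_zero_of_notMem_vars
    intro hv
    have := h _ hv
    simp at this
    omega
  · rw [c_neg n _ _ hi]
    apply pderiv_eq_zero_of_notMem_vars
    intro hv
    have := h _ hv
    simp at this
    omega

lemma fin_c (n : ℕ) (p : P) : (Function.support (fun j => c n j p)).Finite := by
  obtain ⟨N, hN⟩ := exists_Bd p
  apply (Set.finite_Icc (-(N : ℤ)) N).subset
  intro j hj
  by_contra hc
  apply hj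
  apply c_vanish n hN
  simp only [Set.mem_Icc, not_and_or, not_le] at hc
  exact hc

/-- any family of linear operators applied to c gives a finite support -/
lemma fin_F (n : ℕ) (p : P) (k : ℤ) (F : ℤ → P →ₗ[ℂ] P) :
    (Function.support (fun m => F m (c n (k - m) p))).Finite := by
  have := (fin_c n p).preimage ((Equiv.subLeft k).injective.injOn)
  apply this.subset
  intro j hj hc
  apply hj
  simp only [Equiv.subLeft_apply] at hc
  simp [hc]

lemma sum_Ico (f : ℤ → P) (a : ℤ) (N : ℕ) :
    ∑ i ∈ Finset.Ico a (a + N), f i = ∑ i ∈ Finset.range N, f (a + i) := by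
  symm
  apply Finset.sum_bij (fun (i : ℕ) _ => a + (i : ℤ))
  · intro i hi; simp at hi ⊢; omega
  · intro i _ j _ h; omega
  · intro z hz; simp at hz; exact ⟨(z - a).toNat, by simp; omega, by omega⟩
  · intros; rfl

lemma finsum_split (f : ℤ → P) (N R : ℕ) (h : ∀ j : ℤ, (j < -N ∨ (R : ℤ) < j) → f j = 0) :
    ∑ᶠ j, f j = ∑ i ∈ Finset.range N, f (-((i : ℤ) + 1)) + f 0 +
      ∑ i ∈ Finset.range R, f ((i : ℤ) + 1) := by
  have h1 : ∑ᶠ j, f j = ∑ j ∈ Finset.Ico (-(N : ℤ)) (-(N : ℤ) + ((N + (1 + R) : ℕ) : ℤ)), f j := by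
    apply finsum_eq_sum_of_support_subset
    intro j hj
    by_contra hc
    apply hj
    apply h
    simp only [Finset.coe_Ico, Set.mem_Ico, not_and_or, not_le, not_lt] at hc
    push_cast at hc
    omega
  rw [h1, sum_Ico, Finset.sum_range_add, Finset.sum_range_add, ← Finset.sum_range_reflect,
    Finset.sum_range_one, ← add_assoc]
  congr 1
  · congr 1
    · apply Finset.sum_congr rfl
      intro i hi
      simp at hi
      congr 1
      omega
    · congr 1
      simp
  · apply Finset.sum_congr rfl
    intro i hi
    congr 1
    push_cast
    ring

/-- the structural hypothesis on L -/
def Str (n : ℕ) (L : ℤ → Module.End ℂ P) : Prop :=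
  ∀ (k : ℤ) (p : P), L k p = ∑ᶠ m : ℤ, b m (c n (k - m) p)

lemma fin_single (a : ℤ) (F : ℤ → P) (h : ∀ i, i ≠ a → F i = 0) :
    (Function.support F).Finite := by
  apply (Set.finite_singleton a).subset
  intro i hi
  by_contra hc
  exact hi (h i hc)

lemma L_b {n : ℕ} {L : ℤ → Module.End ℂ P} (hL : Str n L) (k m : ℤ) (p : P) :
    L k (b m p) = b m (L k p) - (m : ℂ) • b (k + m) p := by
  have hz : ∀ i : ℤ, i ≠ k + m → (if m + (k - i) = 0 then -(m : ℂ) else 0) • b i p = 0 := by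
    intro i hi
    rw [if_neg (by omega), zero_smul]
  rw [hL, hL, map_finsum _ (fin_F n p k b)]
  simp only [c_b, map_add, map_smul, b_comm _ m]
  have hf := fin_F n p k (fun i => b m ∘ₗ b i)
  simp only [LinearMap.comp_apply] at hf
  rw [finsum_add_distrib hf (fin_single _ _ hz),
    finsum_eq_single _ _ hz, if_pos (by omega), neg_smul, sub_eq_add_neg]

lemma L_c {n : ℕ} {L : ℤ → Module.End ℂ P} (hL : Str n L) (k j : ℤ) (p : P) :
    L k (c n j p) = c n j (L k p) - (j : ℂ) • c n (k + j) p := by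
  have hz : ∀ i : ℤ, i ≠ -j → (if i + j = 0 then -(i : ℂ) else 0) • c n (k - i) p = 0 := by
    intro i hi
    rw [if_neg (by omega), zero_smul]
  rw [hL, hL, map_finsum _ (fin_F n p k b)]
  simp only [c_b, c_comm n j]
  have hf := fin_F n (c n j p) k b
  rw [finsum_add_distrib hf (fin_single _ _ hz),
    finsum_eq_single _ _ hz, if_pos (by omega)]
  simp

lemma L_L {n : ℕ} {L : ℤ → Module.End ℂ P} (hL : Str n L) (k l : ℤ) (p : P) :
    L k (L l p) = L l (L k p) + ((k - l : ℤ) : ℂ) • L (k + l) p := by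
  have e1 : ∑ᶠ m : ℤ, (m : ℂ) • b (k + m) (c n (l - m) p) =
      ∑ᶠ m : ℤ, ((m - k : ℤ) : ℂ) • b m (c n (k + l - m) p) := by
    rw [← finsum_comp_equiv (Equiv.addLeft k)
      (f := fun m : ℤ => ((m - k : ℤ) : ℂ) • b m (c n (k + l - m) p))]
    apply finsum_congr
    intro m
    simp only [Equiv.coe_addLeft]
    rw [show k + m - k = m by ring, show k + l - (k + m) = l - m by ring]
  have f1 := fin_F n (L k p) l b
  have f2 := fin_F n p (k + l) (fun m => ((l - m : ℤ) : ℂ) • b m)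
  have f3 := fin_F n p l (fun m => (m : ℂ) • b (k + m))
  have f4 := fin_F n p (k + l) (fun m => ((m - k : ℤ) : ℂ) • b m)
  have f5 := fin_F n p (k + l) b
  simp only [LinearMap.smul_apply] at f2 f3 f4
  have e2 : L k (L l p) = ∑ᶠ m : ℤ, (b m (c n (l - m) (L k p)) -
      ((l - m : ℤ) : ℂ) • b m (c n (k + l - m) p) - (m : ℂ) • b (k + m) (c n (l - m) p)) := by
    rw [hL l p, map_finsum _ (fin_F n p l b)]
    apply finsum_congr
    intro m
    rw [L_b hL, L_c hL, map_sub, map_smul, show k + (l - m) = k + l - m by ring]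
  rw [e2, finsum_sub_distrib ((f1.union f2).subset (Function.support_sub _ _)) f3,
    finsum_sub_distrib f1 f2, e1, ← hL l (L k p), hL (k + l) p, smul_finsum' _ f5,
    sub_sub, ← finsum_add_distrib f2 f4, sub_eq_add_neg, ← finsum_neg_distrib]
  congr 1
  apply finsum_congr
  intro m
  push_cast
  module

lemma sum_Ioo (f : ℕ → P) (K : ℕ) :
    ∑ j ∈ Finset.Ioo 0 (K + 1), f j = ∑ i ∈ Finset.range K, f (i + 1) := by
  have : Finset.Ioo 0 (K + 1) = Finset.Ico 1 (K + 1) := by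
    ext; simp only [Finset.mem_Ioo, Finset.mem_Icc, Finset.mem_Ico]; omega
  rw [this, Finset.sum_Ico_eq_sum_range]
  simp [add_comm]

lemma sum_Icc (f : ℕ → P) (K : ℕ) :
    ∑ j ∈ Finset.Icc 1 K, f j = ∑ i ∈ Finset.range K, f (i + 1) := by
  have : Finset.Icc 1 K = Finset.Ico 1 (K + 1) := by
    ext; simp only [Finset.mem_Ioo, Finset.mem_Icc, Finset.mem_Ico]; omega
  rw [this, Finset.sum_Ico_eq_sum_range]
  simp [add_comm]

lemma sum_Ioc (f : ℕ → P) (k N : ℕ) :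
    ∑ j ∈ Finset.Ioc k (N + k), f j = ∑ i ∈ Finset.range N, f (i + k + 1) := by
  have : Finset.Ioc k (N + k) = Finset.Ico (k + 1) (N + k + 1) := by ext; simp only [Finset.mem_Ioc, Finset.mem_Ico]; omega
  rw [this, Finset.sum_Ico_eq_sum_range, show N + k + 1 - (k + 1) = N by omega]
  apply Finset.sum_congr rfl
  intro i _
  congr 1
  ring

lemma str_zero (n : ℕ) (p : P) (N : ℕ) (hN : Bd p N) :
    ∑ j ∈ Finset.Icc 1 N, (j : ℂ) • (X (Sum.inl (j - 1)) * pderiv (Sum.inl (j - 1)) p)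
        - ∑ j ∈ Finset.Icc 1 N,
            (j : ℂ) • (X (Sum.inr (j - 1)) * pderiv (Sum.inr (j - 1)) p) =
    ∑ᶠ m : ℤ, b m (c n (0 - m) p) := by
  rw [finsum_split _ N N, sum_Icc, sum_Icc, ← Finset.sum_sub_distrib, b_zero', add_zero,
    ← Finset.sum_add_distrib]
  · apply Finset.sum_congr rfl
    intro i _
    rw [c_pos n _ i (by ring), c_neg n (0 - ((i : ℤ) + 1)) i (by ring), b_pos', b_neg',
      pd_comm (Sum.inl i)]
    simp only [Nat.add_sub_cancel]
    push_cast
    abel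
  · intro j hj
    rw [c_vanish n hN _ (by omega), map_zero]

lemma str_pos (n : ℕ) (K : ℕ) (p : P) (N : ℕ) (hN : Bd p N) :
    ∑ j ∈ Finset.Ioo 0 (K + 1), pderiv (Sum.inl (j - 1)) (pderiv (Sum.inl (K + 1 - j - 1)) p)
        + (n : ℂ) • pderiv (Sum.inl (K + 1 - 1)) p
        + ∑ j ∈ Finset.Icc 1 N,
            (j : ℂ) • (X (Sum.inl (j - 1)) * pderiv (Sum.inl (j + (K + 1) - 1)) p)
        - ∑ j ∈ Finset.Ioc (K + 1) (N + (K + 1)),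
            (j : ℂ) • (X (Sum.inr (j - 1)) * pderiv (Sum.inr (j - (K + 1) - 1)) p)
        - ∑ j ∈ Finset.Ioo 0 (K + 1),
            (j : ℂ) • (X (Sum.inr (j - 1)) * pderiv (Sum.inl (K + 1 - j - 1)) p)
        - ((n * (K + 1) : ℕ) : ℂ) • (X (Sum.inr (K + 1 - 1)) * p) =
    ∑ᶠ m : ℤ, b m (c n (((K + 1 : ℕ) : ℤ) - m) p) := by
  rw [finsum_split _ N (K + (1 + N)), sum_Icc, sum_Ioo, sum_Ioo, sum_Ioc, b_zero', add_zero,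
    Finset.sum_range_add, Finset.sum_range_add, Finset.sum_range_one]
  · have h1 : ∑ i ∈ Finset.range N,
        b (-((i : ℤ) + 1)) (c n (((K + 1 : ℕ) : ℤ) - -((i : ℤ) + 1)) p) =
        ∑ i ∈ Finset.range N, ((i + 1 : ℕ) : ℂ) • (X (Sum.inl (i + 1 - 1)) *
          pderiv (Sum.inl (i + 1 + (K + 1) - 1)) p) -
        ∑ i ∈ Finset.range N, pderiv (Sum.inr i) (pderiv (Sum.inl (i + (K + 1))) p) := by
      rw [← Finset.sum_sub_distrib]
      apply Finset.sum_congr rfl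
      intro i _
      rw [c_pos n _ (i + (K + 1)) (by push_cast; ring), b_neg',
        show i + 1 + (K + 1) - 1 = i + (K + 1) by omega]
      simp only [Nat.add_sub_cancel]
      push_cast
      rfl
    have h2 : ∑ i ∈ Finset.range K,
        b ((i : ℤ) + 1) (c n (((K + 1 : ℕ) : ℤ) - ((i : ℤ) + 1)) p) =
        ∑ i ∈ Finset.range K, pderiv (Sum.inl (i + 1 - 1))
          (pderiv (Sum.inl (K + 1 - (i + 1) - 1)) p) -
        ∑ i ∈ Finset.range K, ((i + 1 : ℕ) : ℂ) • (X (Sum.inr (i + 1 - 1)) *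
          pderiv (Sum.inl (K + 1 - (i + 1) - 1)) p) := by
      rw [← Finset.sum_sub_distrib]
      apply Finset.sum_congr rfl
      intro i hi
      have hi' := Finset.mem_range.1 hi
      rw [c_pos n _ (K + 1 - (i + 1) - 1) (by omega), b_pos']
      simp only [Nat.add_sub_cancel]
      push_cast
      rfl
    have h3 : b (((K + 0 : ℕ) : ℤ) + 1)
        (c n (((K + 1 : ℕ) : ℤ) - (((K + 0 : ℕ) : ℤ) + 1)) p) =
        (n : ℂ) • pderiv (Sum.inl (K + 1 - 1)) p -
        ((n * (K + 1) : ℕ) : ℂ) • (X (Sum.inr (K + 1 - 1)) * p) := by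
      rw [c_zero n _ (by push_cast; ring), b_pos']
      simp only [Nat.add_sub_cancel, add_zero, Derivation.map_smul, mul_smul_comm]
      push_cast
      module
    have h4 : ∑ i ∈ Finset.range N, b (((K + (1 + i) : ℕ) : ℤ) + 1)
        (c n (((K + 1 : ℕ) : ℤ) - (((K + (1 + i) : ℕ) : ℤ) + 1)) p) =
        ∑ i ∈ Finset.range N, pderiv (Sum.inr i) (pderiv (Sum.inl (i + (K + 1))) p) -
        ∑ i ∈ Finset.range N, ((i + (K + 1) + 1 : ℕ) : ℂ) • (X (Sum.inr (i + (K + 1) + 1 - 1)) *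
          pderiv (Sum.inr (i + (K + 1) + 1 - (K + 1) - 1)) p) := by
      rw [← Finset.sum_sub_distrib]
      apply Finset.sum_congr rfl
      intro i hi
      rw [c_neg n _ i (by push_cast; ring), b_pos',
        show i + (K + 1) + 1 - (K + 1) - 1 = i by omega, show K + (1 + i) = i + (K + 1) by ring,
        pd_comm (Sum.inr i)]
      simp only [Nat.add_sub_cancel]
      push_cast
      rfl
    rw [h1, h2, h3, h4]
    abel
  · intro j hj
    rw [c_vanish n hN _ (by push_cast at hj ⊢; omega), map_zero]

lemma str_neg (n : ℕ) (K : ℕ) (p : P) (N : ℕ) (hN : Bd p N) :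
    - ∑ j ∈ Finset.Ioo 0 (K + 1), pderiv (Sum.inr (j - 1)) (pderiv (Sum.inr (K + 1 - j - 1)) p)
        - (n : ℂ) • pderiv (Sum.inr (K + 1 - 1)) p
        - ∑ j ∈ Finset.Icc 1 N,
            (j : ℂ) • (X (Sum.inr (j - 1)) * pderiv (Sum.inr (j + (K + 1) - 1)) p)
        + ∑ j ∈ Finset.Ioc (K + 1) (N + (K + 1)),
            (j : ℂ) • (X (Sum.inl (j - 1)) * pderiv (Sum.inl (j - (K + 1) - 1)) p)
        + ∑ j ∈ Finset.Ioo 0 (K + 1),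
            (j : ℂ) • (X (Sum.inl (j - 1)) * pderiv (Sum.inr (K + 1 - j - 1)) p)
        + ((n * (K + 1) : ℕ) : ℂ) • (X (Sum.inl (K + 1 - 1)) * p) =
    ∑ᶠ m : ℤ, b m (c n (-((K + 1 : ℕ) : ℤ) - m) p) := by
  rw [← finsum_comp_equiv (Equiv.neg ℤ)]
  simp only [Equiv.neg_apply]
  rw [finsum_split _ N (K + (1 + N)), sum_Icc, sum_Ioo, sum_Ioo, sum_Ioc, neg_zero, b_zero',
    add_zero, Finset.sum_range_add, Finset.sum_range_add, Finset.sum_range_one]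
  · have h1 : ∑ i ∈ Finset.range N,
        b (- -((i : ℤ) + 1)) (c n (-((K + 1 : ℕ) : ℤ) - - -((i : ℤ) + 1)) p) =
        ∑ i ∈ Finset.range N, pderiv (Sum.inl i) (pderiv (Sum.inr (i + (K + 1))) p) -
        ∑ i ∈ Finset.range N, ((i + 1 : ℕ) : ℂ) • (X (Sum.inr (i + 1 - 1)) *
          pderiv (Sum.inr (i + 1 + (K + 1) - 1)) p) := by
      rw [← Finset.sum_sub_distrib]
      apply Finset.sum_congr rfl
      intro i _
      rw [c_neg n _ (i + (K + 1)) (by push_cast; ring), neg_neg, b_pos',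
        show i + 1 + (K + 1) - 1 = i + (K + 1) by omega]
      simp only [Nat.add_sub_cancel]
      push_cast
      rfl
    have h2 : ∑ i ∈ Finset.range K,
        b (-((i : ℤ) + 1)) (c n (-((K + 1 : ℕ) : ℤ) - -((i : ℤ) + 1)) p) =
        ∑ i ∈ Finset.range K, ((i + 1 : ℕ) : ℂ) • (X (Sum.inl (i + 1 - 1)) *
          pderiv (Sum.inr (K + 1 - (i + 1) - 1)) p) -
        ∑ i ∈ Finset.range K, pderiv (Sum.inr (i + 1 - 1))
          (pderiv (Sum.inr (K + 1 - (i + 1) - 1)) p) := by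
      rw [← Finset.sum_sub_distrib]
      apply Finset.sum_congr rfl
      intro i hi
      have hi' := Finset.mem_range.1 hi
      rw [c_neg n _ (K + 1 - (i + 1) - 1) (by omega), b_neg']
      simp only [Nat.add_sub_cancel]
      push_cast
      rfl
    have h3 : b (-(((K + 0 : ℕ) : ℤ) + 1))
        (c n (-((K + 1 : ℕ) : ℤ) - -(((K + 0 : ℕ) : ℤ) + 1)) p) =
        ((n * (K + 1) : ℕ) : ℂ) • (X (Sum.inl (K + 1 - 1)) * p) -
        (n : ℂ) • pderiv (Sum.inr (K + 1 - 1)) p := by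
      rw [c_zero n _ (by push_cast; ring), b_neg']
      simp only [Nat.add_sub_cancel, add_zero, Derivation.map_smul, mul_smul_comm]
      push_cast
      module
    have h4 : ∑ i ∈ Finset.range N, b (-(((K + (1 + i) : ℕ) : ℤ) + 1))
        (c n (-((K + 1 : ℕ) : ℤ) - -(((K + (1 + i) : ℕ) : ℤ) + 1)) p) =
        ∑ i ∈ Finset.range N, ((i + (K + 1) + 1 : ℕ) : ℂ) • (X (Sum.inl (i + (K + 1) + 1 - 1)) *
          pderiv (Sum.inl (i + (K + 1) + 1 - (K + 1) - 1)) p) -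
        ∑ i ∈ Finset.range N, pderiv (Sum.inl i) (pderiv (Sum.inr (i + (K + 1))) p) := by
      rw [← Finset.sum_sub_distrib]
      apply Finset.sum_congr rfl
      intro i hi
      rw [c_pos n _ i (by push_cast; ring), b_neg',
        show i + (K + 1) + 1 - (K + 1) - 1 = i by omega, show K + (1 + i) = i + (K + 1) by ring,
        pd_comm (Sum.inl i)]
      simp only [Nat.add_sub_cancel]
      push_cast
      rfl
    rw [h1, h2, h3, h4]
    abel
  · intro j hj
    rw [c_vanish n hN _ (by push_cast at hj ⊢; omega), map_zero]

end

end ALVir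

/-- The operators `L_k` of the AL Virasoro constraints on `ℂ[t₁,t₂,…,s₁,s₂,…]`
form a centerless Virasoro algebra: `[L_k, L_l] = (k−l) L_{k+l}`.  The variable
`X (Sum.inl j)` of `MvPolynomial (ℕ ⊕ ℕ) ℂ` represents `t_{j+1}` and
`X (Sum.inr j)` represents `s_{j+1}`; the operators are specified by their action
on each polynomial `p`, the infinite sums being evaluated as finite sums over
indices up to any bound `N` beyond the variables occurring in `p`. -/
theorem AL_virasoro_centerless (n : ℕ) (hn : 1 ≤ n)
    (L : ℤ → Module.End ℂ (MvPolynomial (ℕ ⊕ ℕ) ℂ))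
    (hzero : ∀ (p : MvPolynomial (ℕ ⊕ ℕ) ℂ) (N : ℕ),
      (∀ v ∈ p.vars, Sum.elim (fun a => a < N) (fun a => a < N) v) →
      L 0 p = ∑ j ∈ Finset.Icc 1 N,
            (j : ℂ) • (X (Sum.inl (j - 1)) * pderiv (Sum.inl (j - 1)) p)
        - ∑ j ∈ Finset.Icc 1 N,
            (j : ℂ) • (X (Sum.inr (j - 1)) * pderiv (Sum.inr (j - 1)) p))
    (hpos : ∀ (k : ℕ), 0 < k → ∀ (p : MvPolynomial (ℕ ⊕ ℕ) ℂ) (N : ℕ),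
      (∀ v ∈ p.vars, Sum.elim (fun a => a < N) (fun a => a < N) v) →
      L k p =
        ∑ j ∈ Finset.Ioo 0 k, pderiv (Sum.inl (j - 1)) (pderiv (Sum.inl (k - j - 1)) p)
        + (n : ℂ) • pderiv (Sum.inl (k - 1)) p
        + ∑ j ∈ Finset.Icc 1 N,
            (j : ℂ) • (X (Sum.inl (j - 1)) * pderiv (Sum.inl (j + k - 1)) p)
        - ∑ j ∈ Finset.Ioc k (N + k),
            (j : ℂ) • (X (Sum.inr (j - 1)) * pderiv (Sum.inr (j - k - 1)) p)
        - ∑ j ∈ Finset.Ioo 0 k,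
            (j : ℂ) • (X (Sum.inr (j - 1)) * pderiv (Sum.inl (k - j - 1)) p)
        - ((n * k : ℕ) : ℂ) • (X (Sum.inr (k - 1)) * p))
    (hneg : ∀ (k : ℕ), 0 < k → ∀ (p : MvPolynomial (ℕ ⊕ ℕ) ℂ) (N : ℕ),
      (∀ v ∈ p.vars, Sum.elim (fun a => a < N) (fun a => a < N) v) →
      L (-(k : ℤ)) p =
        - ∑ j ∈ Finset.Ioo 0 k, pderiv (Sum.inr (j - 1)) (pderiv (Sum.inr (k - j - 1)) p)
        - (n : ℂ) • pderiv (Sum.inr (k - 1)) p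
        - ∑ j ∈ Finset.Icc 1 N,
            (j : ℂ) • (X (Sum.inr (j - 1)) * pderiv (Sum.inr (j + k - 1)) p)
        + ∑ j ∈ Finset.Ioc k (N + k),
            (j : ℂ) • (X (Sum.inl (j - 1)) * pderiv (Sum.inl (j - k - 1)) p)
        + ∑ j ∈ Finset.Ioo 0 k,
            (j : ℂ) • (X (Sum.inl (j - 1)) * pderiv (Sum.inr (k - j - 1)) p)
        + ((n * k : ℕ) : ℂ) • (X (Sum.inl (k - 1)) * p)) :
    ∀ k l : ℤ, ⁅L k, L l⁆ = ((k - l : ℤ) : ℂ) • L (k + l) := by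
  have hL : ALVir.Str n L := by
    intro k p
    obtain ⟨N, hN⟩ := ALVir.exists_Bd p
    rcases ALVir.int_cases k with rfl | ⟨K, rfl⟩ | ⟨K, rfl⟩
    · rw [hzero p N hN, ALVir.str_zero n p N hN]
    · have := hpos (K + 1) (Nat.succ_pos K) p N hN
      rw [ALVir.str_pos n K p N hN] at this
      exact_mod_cast this
    · have := hneg (K + 1) (Nat.succ_pos K) p N hN
      rw [ALVir.str_neg n K p N hN] at this
      exact_mod_cast this
  intro k l
  apply LinearMap.ext
  intro p
  have := ALVir.L_L hL k l p
  rw [LieRing.of_associative_ring_bracket, LinearMap.sub_apply, Module.End.mul_apply,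
    Module.End.mul_apply, this, LinearMap.smul_apply]
  abel
end

section
/- Let L be a Toeplitz bilinear form on C[z,z⁻¹] and {f_n, g_n} a sequence of Laurent polynomials. Define p_{2n}^{(1)}(z) = zⁿ g_{2n}(z⁻¹), p_{2n+1}^{(1)}(z) = zⁿ f_{2n+1}(z), p_{2n}^{(2)}(z) = zⁿ f_{2n}(z⁻¹), p_{2n+1}^{(2)}(z) = zⁿ g_{2n+1}(z). Then {f_n, g_n} is a sequence of right bi-orthogonal L-polynomials with respect to L if and only if {p_n^{(1)}, p_n^{(2)}} is a sequence of bi-orthogonal polynomials with respect to L; moreover L[f_n, g_n] = L[p_n^{(1)}, p_n^{(2)}] for every n. -/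
open LaurentPolynomial

/-- `𝕃⁺_n`: for `n = 2m` the span of `z^{−m},…,z^m`; for `n = 2m+1` the span of
`z^{−m},…,z^{m+1}`. -/
noncomputable def Lplus (n : ℕ) : Submodule ℂ (LaurentPolynomial ℂ) :=
  Submodule.span ℂ {p | ∃ m : ℤ, -((n : ℤ) / 2) ≤ m ∧ m ≤ ((n : ℤ) + 1) / 2 ∧ p = T m}

/-- `𝕃⁻_n`: for `n = 2m` the span of `z^{−m},…,z^m`; for `n = 2m+1` the span of
`z^{−m−1},…,z^m`. -/
noncomputable def Lminus (n : ℕ) : Submodule ℂ (LaurentPolynomial ℂ) :=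
  Submodule.span ℂ {p | ∃ m : ℤ, -(((n : ℤ) + 1) / 2) ≤ m ∧ m ≤ (n : ℤ) / 2 ∧ p = T m}

/-- `𝕃⁺_{n−1}`, with the convention `𝕃⁺_{−1} = {0}`. -/
noncomputable def LplusPred : ℕ → Submodule ℂ (LaurentPolynomial ℂ)
  | 0 => ⊥
  | n + 1 => Lplus n

/-- `𝕃⁻_{n−1}`, with the convention `𝕃⁻_{−1} = {0}`. -/
noncomputable def LminusPred : ℕ → Submodule ℂ (LaurentPolynomial ℂ)
  | 0 => ⊥
  | n + 1 => Lminus n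

/-- `{f_n, g_n}` is a sequence of right bi-orthogonal Laurent polynomials for `L`. -/
def IsRightBiOrtho (L : LaurentPolynomial ℂ →ₗ[ℂ] LaurentPolynomial ℂ →ₗ[ℂ] ℂ)
    (f g : ℕ → LaurentPolynomial ℂ) : Prop :=
  (∀ n, f n ∈ Lplus n ∧ f n ∉ LplusPred n ∧ g n ∈ Lplus n ∧ g n ∉ LplusPred n) ∧
  ∃ h : ℕ → ℂ, (∀ n, h n ≠ 0) ∧ ∀ m n, L (f m) (g n) = if m = n then h n else 0

/-- `{f_n, g_n}` is a sequence of left bi-orthogonal Laurent polynomials for `L`. -/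
def IsLeftBiOrtho (L : LaurentPolynomial ℂ →ₗ[ℂ] LaurentPolynomial ℂ →ₗ[ℂ] ℂ)
    (f g : ℕ → LaurentPolynomial ℂ) : Prop :=
  (∀ n, f n ∈ Lminus n ∧ f n ∉ LminusPred n ∧ g n ∈ Lminus n ∧ g n ∉ LminusPred n) ∧
  ∃ h : ℕ → ℂ, (∀ n, h n ≠ 0) ∧ ∀ m n, L (f m) (g n) = if m = n then h n else 0

/-- The span of `1, z, …, z^n`: polynomials of degree at most `n`. -/
noncomputable def Pdeg (n : ℕ) : Submodule ℂ (LaurentPolynomial ℂ) :=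
  Submodule.span ℂ {p | ∃ k : ℕ, k ≤ n ∧ p = T k}

/-- Polynomials of degree at most `n − 1`, with the convention `= {0}` for `n = 0`. -/
noncomputable def PdegPred : ℕ → Submodule ℂ (LaurentPolynomial ℂ)
  | 0 => ⊥
  | n + 1 => Pdeg n

/-- `{p_n^{(1)}, p_n^{(2)}}` is a sequence of bi-orthogonal polynomials for `L`:
each has exact degree `n` and `L[p_m^{(1)}, p_n^{(2)}] = h_n δ_{mn}` with `h_n ≠ 0`. -/
def IsBiOrthoPoly (L : LaurentPolynomial ℂ →ₗ[ℂ] LaurentPolynomial ℂ →ₗ[ℂ] ℂ)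
    (p1 p2 : ℕ → LaurentPolynomial ℂ) : Prop :=
  (∀ n, p1 n ∈ Pdeg n ∧ p1 n ∉ PdegPred n ∧ p2 n ∈ Pdeg n ∧ p2 n ∉ PdegPred n) ∧
  ∃ h : ℕ → ℂ, (∀ n, h n ≠ 0) ∧ ∀ m n, L (p1 m) (p2 n) = if m = n then h n else 0

/-- `p_{2n}^{(1)}(z) = zⁿ g_{2n}(z⁻¹)`, `p_{2n+1}^{(1)}(z) = zⁿ f_{2n+1}(z)`. -/
noncomputable def pOne (f g : ℕ → LaurentPolynomial ℂ) (n : ℕ) : LaurentPolynomial ℂ :=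
  if Even n then T ((n / 2 : ℕ) : ℤ) * invert (g n) else T ((n / 2 : ℕ) : ℤ) * f n

/-- `p_{2n}^{(2)}(z) = zⁿ f_{2n}(z⁻¹)`, `p_{2n+1}^{(2)}(z) = zⁿ g_{2n+1}(z)`. -/
noncomputable def pTwo (f g : ℕ → LaurentPolynomial ℂ) (n : ℕ) : LaurentPolynomial ℂ :=
  if Even n then T ((n / 2 : ℕ) : ℤ) * invert (f n) else T ((n / 2 : ℕ) : ℤ) * g n

/-- The span of `T m` for `a ≤ m ≤ b`. -/
noncomputable def SInt (a b : ℤ) : Submodule ℂ (LaurentPolynomial ℂ) :=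
  Submodule.span ℂ {p | ∃ m : ℤ, a ≤ m ∧ m ≤ b ∧ p = T m}

lemma T_mem_SInt {a b m : ℤ} (h1 : a ≤ m) (h2 : m ≤ b) : T m ∈ SInt a b :=
  Submodule.subset_span ⟨m, h1, h2, rfl⟩

lemma SInt_le {a b : ℤ} {V : Submodule ℂ (LaurentPolynomial ℂ)}
    (h : ∀ m, a ≤ m → m ≤ b → T m ∈ V) : SInt a b ≤ V := by
  refine Submodule.span_le.2 ?_
  rintro _ ⟨m, h1, h2, rfl⟩
  exact h m h1 h2

lemma Lplus_eq (n : ℕ) : Lplus n = SInt (-((n : ℤ) / 2)) (((n : ℤ) + 1) / 2) := rfl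

lemma LplusPred_eq (n : ℕ) : LplusPred n = SInt (-(((n : ℤ) - 1) / 2)) ((n : ℤ) / 2) := by
  cases n with
  | zero =>
    refine (le_antisymm bot_le (SInt_le ?_))
    intro m h1 h2
    exfalso
    norm_num at h1 h2
    omega
  | succ n =>
    show Lplus n = _
    rw [Lplus_eq]
    congr 2 <;> push_cast <;> omega

lemma Pdeg_eq (n : ℕ) : Pdeg n = SInt 0 n := by
  apply le_antisymm
  · refine Submodule.span_le.2 ?_
    rintro _ ⟨m, h1, rfl⟩
    exact T_mem_SInt (by omega) (by omega)
  · refine SInt_le ?_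
    intro m h1 h2
    exact Submodule.subset_span ⟨m.toNat, by omega, by rw [Int.toNat_of_nonneg h1]⟩

lemma PdegPred_eq (n : ℕ) : PdegPred n = SInt 0 ((n : ℤ) - 1) := by
  cases n with
  | zero =>
    refine (le_antisymm bot_le (SInt_le ?_))
    intro m h1 h2
    exfalso
    norm_num at h1 h2
    omega
  | succ n =>
    show Pdeg n = _
    rw [Pdeg_eq]
    congr 1; push_cast; omega

lemma mul_mem_SInt_of {a b k a' b' : ℤ} (ha : a' = a + k) (hb : b' = b + k)
    {f : LaurentPolynomial ℂ} (hf : f ∈ SInt a b) : T k * f ∈ SInt a' b' := by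
  have : SInt a b ≤ (SInt a' b').comap (LinearMap.mulLeft ℂ (T k : LaurentPolynomial ℂ)) := by
    refine SInt_le ?_
    intro m h1 h2
    simp only [Submodule.mem_comap, LinearMap.mulLeft_apply, ← T_add]
    exact T_mem_SInt (by omega) (by omega)
  exact this hf

lemma T_neg_mul (k : ℤ) (f : LaurentPolynomial ℂ) : T (-k) * (T k * f) = f := by
  rw [← mul_assoc, ← T_add]; simp

lemma T_mul_neg (k : ℤ) (f : LaurentPolynomial ℂ) : T k * (T (-k) * f) = f := by
  rw [← mul_assoc, ← T_add]; simp

lemma mul_mem_SInt {a b k a' b' : ℤ} (ha : a' = a + k) (hb : b' = b + k)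
    {f : LaurentPolynomial ℂ} : T k * f ∈ SInt a' b' ↔ f ∈ SInt a b := by
  refine ⟨fun h => ?_, mul_mem_SInt_of ha hb⟩
  have := mul_mem_SInt_of (k := -k) (a' := a) (b' := b) (by omega) (by omega) h
  rwa [T_neg_mul] at this

lemma invert_mem_SInt_of {a b a' b' : ℤ} (ha : a' = -b) (hb : b' = -a)
    {f : LaurentPolynomial ℂ} (hf : f ∈ SInt a b) : invert f ∈ SInt a' b' := by
  have : SInt a b ≤ (SInt a' b').comap
      ((invert : LaurentPolynomial ℂ ≃ₐ[ℂ] LaurentPolynomial ℂ).toLinearMap) := by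
    refine SInt_le ?_
    intro m h1 h2
    simp only [Submodule.mem_comap, AlgEquiv.toLinearMap_apply, invert_T]
    exact T_mem_SInt (by omega) (by omega)
  exact this hf

lemma inv_inv' (f : LaurentPolynomial ℂ) : invert (invert f) = f :=
  involutive_invert f

lemma invert_mem_SInt {a b a' b' : ℤ} (ha : a' = -b) (hb : b' = -a)
    {f : LaurentPolynomial ℂ} : invert f ∈ SInt a' b' ↔ f ∈ SInt a b := by
  refine ⟨fun h => ?_, invert_mem_SInt_of ha hb⟩
  have := invert_mem_SInt_of (a' := a) (b' := b) (by omega) (by omega) h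
  rwa [inv_inv'] at this

/-- The transformation carrying `𝕃⁺_n` to polynomials of degree at most `n`. -/
noncomputable def EE (n : ℕ) (f : LaurentPolynomial ℂ) : LaurentPolynomial ℂ :=
  if Even n then T ((n / 2 : ℕ) : ℤ) * invert f else T ((n / 2 : ℕ) : ℤ) * f

lemma EE_surj (n : ℕ) (y : LaurentPolynomial ℂ) : ∃ x, EE n x = y := by
  by_cases h : Even n
  · exact ⟨invert (T (-((n / 2 : ℕ) : ℤ)) * y), by
      simp only [EE, h, if_true]; rw [inv_inv', T_mul_neg]⟩
  · exact ⟨T (-((n / 2 : ℕ) : ℤ)) * y, by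
      simp only [EE, h, if_false]; rw [T_mul_neg]⟩

lemma EE_mem (n : ℕ) (f : LaurentPolynomial ℂ) : EE n f ∈ Pdeg n ↔ f ∈ Lplus n := by
  rw [Pdeg_eq, Lplus_eq]
  by_cases h : Even n
  · obtain ⟨k, rfl⟩ := h
    simp only [EE, Even.add_self, if_true]
    rw [mul_mem_SInt (a := -k) (b := k) (by omega) (by omega)]
    exact invert_mem_SInt (by omega) (by omega)
  · simp only [EE, h, if_false]
    obtain ⟨k, rfl⟩ := Nat.not_even_iff_odd.1 h
    exact mul_mem_SInt (by omega) (by omega)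

lemma EE_memPred (n : ℕ) (f : LaurentPolynomial ℂ) : EE n f ∈ PdegPred n ↔ f ∈ LplusPred n := by
  rw [PdegPred_eq, LplusPred_eq]
  by_cases h : Even n
  · obtain ⟨k, rfl⟩ := h
    simp only [EE, Even.add_self, if_true]
    rw [mul_mem_SInt (a := -k) (b := k - 1) (by omega) (by omega)]
    exact invert_mem_SInt (by omega) (by omega)
  · simp only [EE, h, if_false]
    obtain ⟨k, rfl⟩ := Nat.not_even_iff_odd.1 h
    exact mul_mem_SInt (by omega) (by omega)

section
variable (L : LaurentPolynomial ℂ →ₗ[ℂ] LaurentPolynomial ℂ →ₗ[ℂ] ℂ)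

lemma bilin_ext (L M : LaurentPolynomial ℂ →ₗ[ℂ] LaurentPolynomial ℂ →ₗ[ℂ] ℂ)
    (h : ∀ m n : ℤ, L (T m) (T n) = M (T m) (T n)) (x y : LaurentPolynomial ℂ) :
    L x y = M x y := by
  induction x using LaurentPolynomial.induction_on' with
  | add p q hp hq => simp [hp, hq]
  | C_mul_T m a =>
    induction y using LaurentPolynomial.induction_on' with
    | add p q hp hq => rw [map_add, map_add, hp, hq]
    | C_mul_T n b => simp only [← smul_eq_C_mul, map_smul, LinearMap.smul_apply, h]

lemma L_shift (hT : ∀ m n : ℤ, L (T m) (T n) = L (T (m - n)) 1) (k : ℤ)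
    (x y : LaurentPolynomial ℂ) : L (T k * x) (T k * y) = L x y := by
  refine bilin_ext (L.compl₁₂ (LinearMap.mulLeft ℂ (T k : LaurentPolynomial ℂ))
    (LinearMap.mulLeft ℂ (T k : LaurentPolynomial ℂ))) L ?_ x y
  intro m n
  simp only [LinearMap.compl₁₂_apply, LinearMap.mulLeft_apply, ← T_add]
  rw [hT, hT m n]
  congr 3; ring

lemma L_invert (hT : ∀ m n : ℤ, L (T m) (T n) = L (T (m - n)) 1)
    (x y : LaurentPolynomial ℂ) : L (invert x) (invert y) = L y x := by
  refine bilin_ext (L.compl₁₂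
    ((invert : LaurentPolynomial ℂ ≃ₐ[ℂ] LaurentPolynomial ℂ).toLinearMap)
    ((invert : LaurentPolynomial ℂ ≃ₐ[ℂ] LaurentPolynomial ℂ).toLinearMap)) L.flip ?_ x y
  intro m n
  simp only [LinearMap.compl₁₂_apply, AlgEquiv.toLinearMap_apply, invert_T, LinearMap.flip_apply]
  rw [hT, hT n m]
  congr 3; ring

lemma L_EE_even (hT : ∀ m n : ℤ, L (T m) (T n) = L (T (m - n)) 1) {n : ℕ} (h : Even n)
    (x y : LaurentPolynomial ℂ) : L (EE n x) (EE n y) = L y x := by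
  simp only [EE, h, if_true]; rw [L_shift L hT, L_invert L hT]

lemma L_EE_odd (hT : ∀ m n : ℤ, L (T m) (T n) = L (T (m - n)) 1) {n : ℕ} (h : ¬ Even n)
    (x y : LaurentPolynomial ℂ) : L (EE n x) (EE n y) = L x y := by
  simp only [EE, h, if_false]; rw [L_shift L hT]

end

lemma flag_le {M : Type*} [AddCommGroup M] [Module ℂ M] (W : ℕ → Submodule ℂ M) (t u : ℕ → M)
    (h0 : W 0 = ⊥) (hW : ∀ n, W (n + 1) ≤ W n ⊔ Submodule.span ℂ {t n})
    (hu : ∀ n, u n ∈ W (n + 1)) (hu' : ∀ n, u n ∉ W n) (n : ℕ) :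
    W n ≤ Submodule.span ℂ (u '' {j | j < n}) := by
  induction n with
  | zero => rw [h0]; exact bot_le
  | succ n ih =>
    have hmono : Submodule.span ℂ (u '' {j | j < n}) ≤ Submodule.span ℂ (u '' {j | j < n + 1}) :=
      Submodule.span_mono (Set.image_mono fun j (hj : j < n) => Nat.lt_succ_of_lt hj)
    have hWn := ih.trans hmono
    refine (hW n).trans (sup_le hWn ?_)
    rw [Submodule.span_singleton_le_iff_mem]
    obtain ⟨w, hw, s, hs, e⟩ := Submodule.mem_sup.1 (hW n (hu n))
    obtain ⟨c, rfl⟩ := Submodule.mem_span_singleton.1 hs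
    have hc : c ≠ 0 := by
      rintro rfl
      apply hu' n
      rw [← e]; simpa using hw
    have ht : t n = c⁻¹ • (u n - w) := by
      rw [← e, add_sub_cancel_left, smul_smul, inv_mul_cancel₀ hc, one_smul]
    rw [ht]
    refine Submodule.smul_mem _ _ (Submodule.sub_mem _ (Submodule.subset_span ?_) (hWn hw))
    exact ⟨n, Nat.lt_succ_self n, rfl⟩

lemma biortho_iff {M : Type*} [AddCommGroup M] [Module ℂ M] (L : M →ₗ[ℂ] M →ₗ[ℂ] ℂ)
    (W : ℕ → Submodule ℂ M) (t u v : ℕ → M)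
    (h0 : W 0 = ⊥) (hmono : Monotone W) (hW : ∀ n, W (n + 1) ≤ W n ⊔ Submodule.span ℂ {t n})
    (hu : ∀ n, u n ∈ W (n + 1)) (hu' : ∀ n, u n ∉ W n)
    (hv : ∀ n, v n ∈ W (n + 1)) (hv' : ∀ n, v n ∉ W n) :
    (∃ h : ℕ → ℂ, (∀ n, h n ≠ 0) ∧ ∀ m n, L (u m) (v n) = if m = n then h n else 0) ↔
    ∀ n, (∀ x ∈ W n, L (u n) x = 0) ∧ (∀ x ∈ W n, L x (v n) = 0) ∧ L (u n) (v n) ≠ 0 := by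
  constructor
  · rintro ⟨h, hh, H⟩ n
    refine ⟨?_, ?_, ?_⟩
    · have : W n ≤ LinearMap.ker (L (u n)) := by
        refine (flag_le W t v h0 hW hv hv' n).trans (Submodule.span_le.2 ?_)
        rintro _ ⟨j, hj, rfl⟩
        have hj' : j < n := hj
        simp [H, hj'.ne']
      exact fun x hx => this hx
    · have : W n ≤ LinearMap.ker (L.flip (v n)) := by
        refine (flag_le W t u h0 hW hu hu' n).trans (Submodule.span_le.2 ?_)
        rintro _ ⟨j, hj, rfl⟩
        have hj' : j < n := hj
        simp [H, hj'.ne]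
      exact fun x hx => this hx
    · rw [H, if_pos rfl]; exact hh n
  · intro H
    refine ⟨fun n => L (u n) (v n), fun n => (H n).2.2, fun m n => ?_⟩
    split_ifs with h
    · rw [h]
    · rcases lt_or_gt_of_ne h with h | h
      · exact (H n).2.1 _ (hmono h (hu m))
      · exact (H m).1 _ (hmono h (hv n))

lemma SInt_mono {a b a' b' : ℤ} (h1 : a' ≤ a) (h2 : b ≤ b') : SInt a b ≤ SInt a' b' :=
  SInt_le fun _ h h' => T_mem_SInt (h1.trans h) (h'.trans h2)

lemma Lplus_step (n : ℕ) : LplusPred (n + 1) ≤ LplusPred n ⊔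
    Submodule.span ℂ {T (if Even n then -((n : ℤ) / 2) else ((n : ℤ) + 1) / 2)} := by
  rw [LplusPred_eq, LplusPred_eq]
  refine SInt_le ?_
  intro m h1 h2
  push_cast at h1 h2
  by_cases hm : -(((n : ℤ) - 1) / 2) ≤ m ∧ m ≤ (n : ℤ) / 2
  · exact Submodule.mem_sup_left (T_mem_SInt hm.1 hm.2)
  · apply Submodule.mem_sup_right
    rw [Submodule.mem_span_singleton]
    refine ⟨1, ?_⟩
    rw [one_smul]
    congr 1
    split_ifs with h
    · obtain ⟨k, rfl⟩ := h
      omega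
    · obtain ⟨k, rfl⟩ := Nat.not_even_iff_odd.1 h
      omega

lemma Pdeg_step (n : ℕ) : PdegPred (n + 1) ≤ PdegPred n ⊔
    Submodule.span ℂ {T (n : ℤ)} := by
  rw [PdegPred_eq, PdegPred_eq]
  refine SInt_le ?_
  intro m h1 h2
  push_cast at h1 h2
  by_cases hm : m ≤ (n : ℤ) - 1
  · exact Submodule.mem_sup_left (T_mem_SInt h1 hm)
  · apply Submodule.mem_sup_right
    rw [Submodule.mem_span_singleton]
    refine ⟨1, ?_⟩
    rw [one_smul]
    congr 1
    omega

lemma LplusPred_mono : Monotone LplusPred := by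
  intro a b h
  rw [LplusPred_eq, LplusPred_eq]
  exact SInt_mono (by omega) (by omega)

lemma PdegPred_mono : Monotone PdegPred := by
  intro a b h
  rw [PdegPred_eq, PdegPred_eq]
  exact SInt_mono (by omega) (by omega)

lemma pOne_eq (f g : ℕ → LaurentPolynomial ℂ) (n : ℕ) :
    pOne f g n = EE n (if Even n then g n else f n) := by
  unfold pOne EE; split_ifs <;> rfl

lemma pTwo_eq (f g : ℕ → LaurentPolynomial ℂ) (n : ℕ) :
    pTwo f g n = EE n (if Even n then f n else g n) := by
  unfold pTwo EE; split_ifs <;> rfl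

/-- `{f_n, g_n}` is a sequence of right bi-orthogonal Laurent polynomials for a
Toeplitz bilinear form `L` iff `{p_n^{(1)}, p_n^{(2)}}` is a sequence of
bi-orthogonal polynomials for `L`; moreover `L[f_n, g_n] = L[p_n^{(1)}, p_n^{(2)}]`. -/
theorem right_biortho_iff_biortho_poly
    (L : LaurentPolynomial ℂ →ₗ[ℂ] LaurentPolynomial ℂ →ₗ[ℂ] ℂ)
    (hT : ∀ m n : ℤ, L (T m) (T n) = L (T (m - n)) 1)
    (f g : ℕ → LaurentPolynomial ℂ) :
    (IsRightBiOrtho L f g ↔ IsBiOrthoPoly L (pOne f g) (pTwo f g)) ∧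
    ∀ n, L (f n) (g n) = L (pOne f g n) (pTwo f g n) := by
  have hval : ∀ n, L (f n) (g n) = L (pOne f g n) (pTwo f g n) := by
    intro n
    rw [pOne_eq, pTwo_eq]
    by_cases h : Even n
    · rw [L_EE_even L hT h, if_pos h, if_pos h]
    · rw [L_EE_odd L hT h, if_neg h, if_neg h]
  refine ⟨?_, hval⟩
  have hdeg : (∀ n, f n ∈ Lplus n ∧ f n ∉ LplusPred n ∧ g n ∈ Lplus n ∧ g n ∉ LplusPred n) ↔
      (∀ n, pOne f g n ∈ Pdeg n ∧ pOne f g n ∉ PdegPred n ∧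
        pTwo f g n ∈ Pdeg n ∧ pTwo f g n ∉ PdegPred n) := by
    refine forall_congr' fun n => ?_
    rw [pOne_eq, pTwo_eq, EE_mem, EE_mem, EE_memPred, EE_memPred]
    split_ifs <;> tauto
  unfold IsRightBiOrtho IsBiOrthoPoly
  rw [← hdeg]
  refine and_congr_right fun hd => ?_
  have hd' := hdeg.1 hd
  rw [biortho_iff L LplusPred _ f g rfl LplusPred_mono Lplus_step
      (fun n => (hd n).1) (fun n => (hd n).2.1) (fun n => (hd n).2.2.1) (fun n => (hd n).2.2.2),
    biortho_iff L PdegPred _ (pOne f g) (pTwo f g) rfl PdegPred_mono Pdeg_step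
      (fun n => (hd' n).1) (fun n => (hd' n).2.1) (fun n => (hd' n).2.2.1)
      (fun n => (hd' n).2.2.2)]
  refine forall_congr' fun n => ?_
  have hP : ∀ Q : LaurentPolynomial ℂ → Prop,
      (∀ y ∈ PdegPred n, Q y) ↔ ∀ x ∈ LplusPred n, Q (EE n x) := by
    intro Q
    constructor
    · intro H x hx
      exact H _ ((EE_memPred n x).2 hx)
    · intro H y hy
      obtain ⟨x, rfl⟩ := EE_surj n y
      exact H x ((EE_memPred n x).1 hy)
  rw [hP, hP, ← hval, pOne_eq, pTwo_eq]
  by_cases h : Even n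
  · simp only [L_EE_even L hT h, if_pos h]
    tauto
  · simp only [L_EE_odd L hT h, if_neg h]
end
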